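/- Let G be a nilpotent multiplicative Lie algebra. Then ^M[G,G] ⊆ Φ̃(G), i.e. the multiplicative commutator is contained in the M-Frattini subalgebra. -/

import Mathlib

/-- A multiplicative Lie algebra: a group `G` with a binary operation `⋆`
satisfying the five defining identities (where `ᵍh = g*h*g⁻¹`). -/
class MulLieAlgebra (G : Type*) extends Group G where
  star : G → G → G
  star_self : ∀ g : G, star g g = 1
  star_mul_right : ∀ g h k : G, star g (h * k) = star g h * (h * star g k * h⁻¹)
  star_mul_left : ∀ g h k : G, star (g * h) k = (g * star h k * g⁻¹) * star g k
  star_jacobi : ∀ g h k : G,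
    star (star g h) (h * k * h⁻¹) * star (star h k) (k * g * k⁻¹) *
      star (star k g) (g * h * g⁻¹) = 1
  conj_star : ∀ g h k : G, k * star g h * k⁻¹ = star (k * g * k⁻¹) (k * h * k⁻¹)

namespace MulLieAlgebra

local infixl:72 " ⋆ " => MulLieAlgebra.star

variable {G : Type*} [MulLieAlgebra G]

/-- A subalgebra: a subgroup closed under the Lie product. -/
def IsSubalgebra (H : Subgroup G) : Prop :=
  ∀ x ∈ H, ∀ y ∈ H, (x ⋆ y) ∈ H

/-- An ideal: a normal subgroup `H` with `g ⋆ h ∈ H` for all `g ∈ G`, `h ∈ H`. -/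
def IsIdeal (H : Subgroup G) : Prop :=
  H.Normal ∧ ∀ g : G, ∀ h ∈ H, (g ⋆ h) ∈ H

/-- The subalgebra generated by a subset `X`. -/
def subalgebraClosure (X : Set G) : Subgroup G :=
  sInf {H : Subgroup G | IsSubalgebra H ∧ X ⊆ (H : Set G)}

/-- A maximal (proper) subalgebra. -/
def IsMaximalSubalgebra (M : Subgroup G) : Prop :=
  IsSubalgebra M ∧ M ≠ ⊤ ∧ ∀ N : Subgroup G, IsSubalgebra N → M < N → N = ⊤

/-- The M-Frattini subalgebra `Φ̃(G)`: the intersection of all maximal subalgebras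
(`sInf ∅ = ⊤`, so it equals `G` when there is no maximal subalgebra). -/
def frattini (G : Type*) [MulLieAlgebra G] : Subgroup G :=
  sInf {M : Subgroup G | IsMaximalSubalgebra M}

end MulLieAlgebra

namespace MulLieAlgebra

local infixl:72 " ⋆ " => MulLieAlgebra.star

/-- The upper central series of a multiplicative Lie algebra:
`Z₀ = {1}`, `Z_{k+1} = {g : [g,x] ∈ Z_k and g ⋆ x ∈ Z_k for all x}`. -/
def upperCentral (G : Type*) [MulLieAlgebra G] : ℕ → Set G
  | 0 => {(1 : G)}
  | n + 1 => {g : G | ∀ x : G,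
      g * x * g⁻¹ * x⁻¹ ∈ upperCentral G n ∧ (g ⋆ x) ∈ upperCentral G n}

end MulLieAlgebra

namespace MulLieAlgebra

local infixl:72 " ⋆ " => MulLieAlgebra.star

/-- The multiplicative commutator `^M[G,G]`: the subgroup generated by all
group commutators and all Lie products. -/
def mulCommutator (G : Type*) [MulLieAlgebra G] : Subgroup G :=
  Subgroup.closure
    ({x : G | ∃ a b : G, x = a * b * a⁻¹ * b⁻¹} ∪ {x : G | ∃ a b : G, x = a ⋆ b})

end MulLieAlgebra

namespace MulLieAlgebra

theorem aux_one_star {G : Type*} [MulLieAlgebra G] (x : G) : star (1 : G) x = 1 := by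
  have h := star_mul_left (1 : G) 1 x
  simpa using h

theorem aux_star_antisymm {G : Type*} [MulLieAlgebra G] (g h : G) :
    star g h = (star h g)⁻¹ := by
  have e := star_self (g * h)
  rw [star_mul_left, star_mul_right h g h, star_mul_right g g h, star_self, star_self] at e
  have e2 : g * (star h g * star g h) * g⁻¹ = 1 := by
    rw [← e]; group
  have e3 : star h g * star g h = 1 := conj_eq_one_iff.mp e2
  exact eq_inv_of_mul_eq_one_right e3

theorem aux_upperCentral {G : Type*} [MulLieAlgebra G] (n : ℕ) :
    ∃ H : Subgroup G, H.Normal ∧ (H : Set G) = upperCentral G n := by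
  induction n with
  | zero => exact ⟨⊥, inferInstance, by simp [upperCentral]⟩
  | succ n ih =>
    obtain ⟨H, hN, hH⟩ := ih
    have key : ∀ g : G, g ∈ upperCentral G (n + 1) ↔
        ∀ x : G, g * x * g⁻¹ * x⁻¹ ∈ H ∧ star g x ∈ H := by
      intro g
      simp only [upperCentral, ← hH, Set.mem_setOf_eq, SetLike.mem_coe]
    refine ⟨{ carrier := upperCentral G (n + 1), mul_mem' := ?_, one_mem' := ?_,
              inv_mem' := ?_ }, ⟨?_⟩, rfl⟩
    · intro a b ha hb
      rw [key] at ha hb ⊢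
      intro x
      constructor
      · have := H.mul_mem (hN.conj_mem _ (hb x).1 a) (ha x).1
        convert this using 1
        group
      · rw [star_mul_left]
        exact H.mul_mem (hN.conj_mem _ (hb x).2 a) (ha x).2
    · rw [key]
      intro x
      simp [aux_one_star, H.one_mem]
    · intro a ha
      rw [key] at ha ⊢
      intro x
      constructor
      · have := hN.conj_mem _ (H.inv_mem (ha x).1) a⁻¹
        convert this using 1
        group
      · have e := star_mul_left a⁻¹ a x
        rw [inv_mul_cancel, aux_one_star] at e
        rw [eq_inv_of_mul_eq_one_right e.symm]
        exact H.inv_mem (hN.conj_mem _ (ha x).2 a⁻¹)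
    · intro a ha g
      change a ∈ upperCentral G (n + 1) at ha
      change g * a * g⁻¹ ∈ upperCentral G (n + 1)
      rw [key] at ha ⊢
      intro x
      constructor
      · have := hN.conj_mem _ (ha (g⁻¹ * x * g)).1 g
        convert this using 1
        group
      · have := hN.conj_mem _ (ha (g⁻¹ * x * g)).2 g
        rw [conj_star] at this
        convert this using 2
        group

/-- for a nilpotent multiplicative Lie algebra `G`, the
multiplicative commutator is contained in the M-Frattini subalgebra. -/
theorem mulCommutator_le_frattini_of_nilpotent {G : Type*} [MulLieAlgebra G]
    (hnil : ∃ n : ℕ, upperCentral G n = Set.univ) :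
    mulCommutator G ≤ frattini G := by
  classical
  refine le_sInf ?_
  rintro M ⟨hsub, hne, hmax⟩
  have hex : ∃ n : ℕ, ¬ upperCentral G n ⊆ (M : Set G) := by
    obtain ⟨n, hn⟩ := hnil
    refine ⟨n, fun h => hne ?_⟩
    rw [hn] at h
    exact (Subgroup.eq_top_iff' M).2 fun x => h (Set.mem_univ x)
  obtain ⟨k, hk, hk'⟩ : ∃ k : ℕ, upperCentral G k ⊆ (M : Set G) ∧
      ¬ upperCentral G (k + 1) ⊆ (M : Set G) := by
    by_contra hcon
    push Not at hcon
    obtain ⟨n, hn⟩ := hex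
    refine hn ?_
    clear hn
    induction n with
    | zero =>
      intro x hx
      have : x = 1 := hx
      rw [this]; exact M.one_mem
    | succ n ih => exact hcon n ih
  obtain ⟨H, hHN, hH⟩ := aux_upperCentral (G := G) k
  obtain ⟨K, hKN, hK⟩ := aux_upperCentral (G := G) (k + 1)
  have hHM : H ≤ M := by
    intro x hx
    exact hk (hH ▸ hx)
  have hKH : ∀ z ∈ K, ∀ x : G, z * x * z⁻¹ * x⁻¹ ∈ H ∧ star z x ∈ H := by
    intro z hz x
    have h1 : z ∈ upperCentral G (k + 1) := hK ▸ hz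
    have h2 := h1 x
    rw [← hH] at h2
    exact h2
  have hstar : ∀ x ∈ M ⊔ K, ∀ y ∈ M ⊔ K, star x y ∈ M := by
    intro x hx y hy
    obtain ⟨m, hm, z, hz, rfl⟩ := Subgroup.mem_sup_of_normal_right.1 hx
    obtain ⟨p, hp, w, hw, rfl⟩ := Subgroup.mem_sup_of_normal_right.1 hy
    rw [star_mul_left, star_mul_right m p w, aux_star_antisymm m w]
    exact M.mul_mem (hHM (hHN.conj_mem _ (hKH z hz _).2 _))
      (M.mul_mem (hsub _ hm _ hp)
        (hHM (hHN.conj_mem _ (H.inv_mem (hKH w hw _).2) _)))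
  have htop : M ⊔ K = ⊤ := by
    apply hmax
    · intro x hx y hy
      exact (le_sup_left : M ≤ M ⊔ K) (hstar x hx y hy)
    · refine lt_of_le_of_ne le_sup_left fun h => hk' ?_
      rw [← hK]
      have : K ≤ M := by rw [h]; exact le_sup_right
      exact this
  have hdec : ∀ x : G, ∃ m ∈ M, ∃ z ∈ K, m * z = x := fun x =>
    Subgroup.mem_sup_of_normal_right.1 (htop ▸ Subgroup.mem_top x)
  have hnorm : ∀ x : G, ∀ p ∈ M, x * p * x⁻¹ ∈ M := by
    intro x p hp
    obtain ⟨m, hm, z, hz, rfl⟩ := hdec x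
    have := M.mul_mem (M.mul_mem hm (M.mul_mem (hHM (hKH z hz p).1) hp)) (M.inv_mem hm)
    convert this using 1
    group
  refine (Subgroup.closure_le M).2 ?_
  rintro x (⟨a, b, rfl⟩ | ⟨a, b, rfl⟩)
  · obtain ⟨m, hm, z, hz, rfl⟩ := hdec a
    have := M.mul_mem (hnorm m _ (hHM (hKH z hz b).1))
      (M.mul_mem hm (hnorm b _ (M.inv_mem hm)))
    change m * z * b * (m * z)⁻¹ * b⁻¹ ∈ M
    convert this using 1
    group
  · exact hstar a (htop ▸ Subgroup.mem_top a) b (htop ▸ Subgroup.mem_top b)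

end MulLieAlgebra
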